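/- Let δ ∈ ℝ and let V: [δ,∞) → ℝ be continuous with ∫_δ^∞ e^{V(x)} dx = 1; let μ be the measure e^{V(x)} dx on [δ,∞). Set c_δ := ∫_δ^∞ e^{-s²/2} ds, Φ_δ(r) := (1/c_δ) ∫_δ^r e^{-s²/2} ds for r ≥ δ, and φ(r) := ∫_δ^r e^{V(x)} dx for r ≥ δ. Define α(x) := ( Φ_δ'(Φ_δ^{-1}(φ(x))) / φ'(x) )² = ( e^{-Φ_δ^{-1}(φ(x))²/2} / (c_δ e^{V(x)}) )² for x ≥ δ. Then for every continuously differentiable f: [δ,∞) → ℝ with compact support and ∫ f² dμ = 1, one has ∫ f² log f² dμ ≤ 2 ∫ α(x) f'(x)² μ(dx). -/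

import Mathlib

open MeasureTheory Real Set

/-- `c_δ = ∫_δ^∞ e^{-s²/2} ds`. -/
noncomputable def cdelta (δ : ℝ) : ℝ := ∫ s in Ici δ, Real.exp (-s^2/2)

/-- `Φ_δ(r) = (1/c_δ) ∫_δ^r e^{-s²/2} ds`. -/
noncomputable def Phid (δ r : ℝ) : ℝ := (cdelta δ)⁻¹ * ∫ s in δ..r, Real.exp (-s^2/2)

/-- The inverse of the strictly increasing bijection `Φ_δ : [δ,∞) → [0,1)`. -/
noncomputable def PhidInv (δ u : ℝ) : ℝ := sInf {r : ℝ | δ ≤ r ∧ u ≤ Phid δ r}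

/-- `φ(r) = ∫_δ^r e^{V(x)} dx`. -/
noncomputable def phiV (δ : ℝ) (V : ℝ → ℝ) (r : ℝ) : ℝ := ∫ x in δ..r, Real.exp (V x)

/-- The weight `α(x) = ( e^{-Φ_δ^{-1}(φ(x))²/2} / (c_δ e^{V(x)}) )²`. -/
noncomputable def alpha1 (δ : ℝ) (V : ℝ → ℝ) (x : ℝ) : ℝ :=
  (Real.exp (-(PhidInv δ (phiV δ V x))^2/2) / (cdelta δ * Real.exp (V x)))^2


lemma aux_core (δ b c ε : ℝ) (hδb : δ ≤ b) (hc : 0 < c) (V f S T : ℝ → ℝ)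
    (hV : Continuous V) (hf : ContDiff ℝ 1 f) (hfb : f b = 0)
    (hF : ∫ x in δ..b, f x ^ 2 * Real.exp (V x) = 1)
    (hS : ∀ x ∈ Icc δ b, HasDerivAt S (c * Real.exp (V x + S x ^ 2 / 2)) x)
    (hT : ∀ x ∈ Icc δ b, HasDerivAt T
      (Real.exp (-ε) * (f x ^ 2 * Real.exp (V x)) * (c * Real.exp (T x ^ 2 / 2))) x)
    (hST : S δ = T δ) :
    ∫ x in δ..b, Real.exp (V x) * (f x ^ 2 * Real.log (f x ^ 2)) ≤
      2 * (∫ x in δ..b, Real.exp (V x) *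
        ((Real.exp (-(S x) ^ 2 / 2) / (c * Real.exp (V x))) ^ 2 * (deriv f x) ^ 2)) + ε := by
  have hfc : Continuous f := hf.continuous
  have hfder : Continuous (deriv f) := hf.continuous_deriv le_rfl
  have hSc : ContinuousOn S (Icc δ b) := fun x hx => (hS x hx).continuousAt.continuousWithinAt
  have hTc : ContinuousOn T (Icc δ b) := fun x hx => (hT x hx).continuousAt.continuousWithinAt
  have huI : uIcc δ b = Icc δ b := uIcc_of_le hδb
  set W : ℝ → ℝ := fun x => Real.exp (-(S x) ^ 2 / 2) / c with hW
  set D : ℝ → ℝ := fun x => 2 * f x * deriv f x * (W x * (T x - S x)) +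
    f x ^ 2 * (-(S x) * Real.exp (V x) * (T x - S x) + W x *
      (Real.exp (-ε) * (f x ^ 2 * Real.exp (V x)) * (c * Real.exp (T x ^ 2 / 2)) -
        c * Real.exp (V x + S x ^ 2 / 2))) with hD
  have hVc : ContinuousOn V (Icc δ b) := hV.continuousOn
  have hfc1 : ContinuousOn f (Icc δ b) := hfc.continuousOn
  have hfc2 : ContinuousOn (deriv f) (Icc δ b) := hfder.continuousOn
  have hWc : ContinuousOn W (Icc δ b) := by
    simp only [hW]; fun_prop
  have hDc : ContinuousOn D (Icc δ b) := by
    simp only [hD]; fun_prop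
  have hDint : IntervalIntegrable D volume δ b := by
    apply ContinuousOn.intervalIntegrable; rwa [huI]
  have hDI : ∫ x in δ..b, D x = 0 := by
    have := intervalIntegral.integral_eq_sub_of_hasDerivAt
      (f := fun x => f x ^ 2 * (W x * (T x - S x))) (f' := D) (a := δ) (b := b) ?_ hDint
    · rw [this]; simp [hfb, hST]
    · intro x hx
      rw [huI] at hx
      have h1 : HasDerivAt f (deriv f x) x := (hf.differentiable one_ne_zero x).hasDerivAt
      have h2 := hS x hx
      have h3 := hT x hx
      have h4 : HasDerivAt W (-(S x) * Real.exp (V x)) x := by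
        have := (((h2.pow 2).neg.div_const 2).exp).div_const c
        refine HasDerivAt.congr_deriv this ?_
        simp only [Pi.neg_apply, Pi.pow_apply]
        have e : Real.exp (V x) = Real.exp (-(S x) ^ 2 / 2) * Real.exp (V x + S x ^ 2 / 2) := by
          rw [← Real.exp_add]; congr 1; ring
        rw [e]; field_simp; push_cast; ring
      have h5 := (h1.pow 2).mul (h4.mul (h3.sub h2))
      refine HasDerivAt.congr_deriv h5 ?_
      simp only [hD, Pi.pow_apply, Pi.mul_apply, Pi.sub_apply]; push_cast; ring
  have hFint : IntervalIntegrable (fun x => f x ^ 2 * Real.exp (V x)) volume δ b := by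
    apply Continuous.intervalIntegrable; fun_prop
  have hRc : ContinuousOn (fun x => Real.exp (V x) *
        ((Real.exp (-(S x) ^ 2 / 2) / (c * Real.exp (V x))) ^ 2 * (deriv f x) ^ 2)) (Icc δ b) := by
    have : ∀ x ∈ Icc δ b, c * Real.exp (V x) ≠ 0 := fun x _ => by positivity
    fun_prop (disch := assumption)
  have hRint : IntervalIntegrable (fun x => Real.exp (V x) *
        ((Real.exp (-(S x) ^ 2 / 2) / (c * Real.exp (V x))) ^ 2 * (deriv f x) ^ 2)) volume δ b := by
    apply ContinuousOn.intervalIntegrable; rwa [huI]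
  have hLint : IntervalIntegrable (fun x => Real.exp (V x) * (f x ^ 2 * Real.log (f x ^ 2)))
      volume δ b := by
    apply Continuous.intervalIntegrable
    have : Continuous (fun x => f x ^ 2 * Real.log (f x ^ 2)) :=
      Real.continuous_mul_log.comp (hfc.pow 2)
    fun_prop
  have key : ∀ x ∈ Icc δ b, Real.exp (V x) * (f x ^ 2 * Real.log (f x ^ 2)) ≤
      2 * (Real.exp (V x) *
        ((Real.exp (-(S x) ^ 2 / 2) / (c * Real.exp (V x))) ^ 2 * (deriv f x) ^ 2)) +
      ε * (f x ^ 2 * Real.exp (V x)) + D x := by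
    intro x hx
    set e := Real.exp (V x) with he
    have hepos : 0 < e := Real.exp_pos _
    have h1 : Real.exp (-(S x) ^ 2 / 2) / (c * e) = W x / e := by
      simp only [hW]; field_simp
    rw [h1]
    have hWe : W x * (c * Real.exp (V x + S x ^ 2 / 2)) = e := by
      simp only [hW, he]
      rw [show Real.exp (-(S x) ^ 2 / 2) / c * (c * Real.exp (V x + S x ^ 2 / 2)) =
        Real.exp (-(S x) ^ 2 / 2) * Real.exp (V x + S x ^ 2 / 2) by field_simp, ← Real.exp_add]
      congr 1; ring
    have hWT : W x * (Real.exp (-ε) * (f x ^ 2 * e) * (c * Real.exp (T x ^ 2 / 2))) =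
        e * (f x ^ 2 * Real.exp (-ε + T x ^ 2 / 2 - S x ^ 2 / 2)) := by
      simp only [hW]
      rw [show -ε + T x ^ 2 / 2 - S x ^ 2 / 2 = -ε + T x ^ 2 / 2 + -(S x)^2/2 by ring,
        Real.exp_add, Real.exp_add]
      field_simp
    have hDx : D x = 2 * f x * deriv f x * (W x * (T x - S x)) +
        f x ^ 2 * e * (-(S x) * (T x - S x) +
          f x ^ 2 * Real.exp (-ε + T x ^ 2 / 2 - S x ^ 2 / 2) - 1) := by
      simp only [hD]
      rw [mul_sub (W x) (Real.exp (-ε) * (f x ^ 2 * Real.exp (V x)) * (c * Real.exp (T x ^ 2 / 2))),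
        hWe, ← he, hWT]; ring
    have hlog : f x ^ 2 * Real.log (f x ^ 2) ≤ f x ^ 2 * (ε - T x ^ 2 / 2 + S x ^ 2 / 2 +
          f x ^ 2 * Real.exp (-ε + T x ^ 2 / 2 - S x ^ 2 / 2) - 1) := by
      by_cases h0 : f x = 0
      · simp [h0]
      · apply mul_le_mul_of_nonneg_left _ (sq_nonneg _)
        have hp : 0 < f x ^ 2 := by positivity
        have := Real.log_le_sub_one_of_pos
          (mul_pos hp (Real.exp_pos (-ε + T x ^ 2 / 2 - S x ^ 2 / 2)))
        rw [Real.log_mul hp.ne' (Real.exp_pos _).ne', Real.log_exp] at this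
        linarith
    have hlog2 := mul_le_mul_of_nonneg_left hlog hepos.le
    have hsq : 0 ≤ e * (f x * (T x - S x) + 2 * (W x / e * deriv f x)) ^ 2 := by positivity
    have hsq2 : e * (f x * (T x - S x) + 2 * (W x / e * deriv f x)) ^ 2 =
      e * f x ^ 2 * (T x - S x) ^ 2 + 4 * f x * deriv f x * (W x * (T x - S x)) +
        4 * (e * ((W x / e) ^ 2 * deriv f x ^ 2)) := by
      field_simp; ring
    rw [hDx]
    nlinarith [hlog2, hsq, hsq2]
  have hmono := intervalIntegral.integral_mono_on hδb hLint
    (((hRint.const_mul 2).add (hFint.const_mul ε)).add hDint) key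
  rw [intervalIntegral.integral_add ((hRint.const_mul 2).add (hFint.const_mul ε)) hDint,
    intervalIntegral.integral_add (hRint.const_mul 2) (hFint.const_mul ε), hDI,
    intervalIntegral.integral_const_mul, intervalIntegral.integral_const_mul, hF] at hmono
  linarith

lemma gauss_int : Integrable (fun s : ℝ => Real.exp (-s^2/2)) := by
  have := integrable_exp_neg_mul_sq (b := 1/2) (by norm_num)
  convert this using 3; ring

lemma tail_pos (g : ℝ → ℝ) (δ x : ℝ) (hx : δ ≤ x) (hg : Continuous g) (hp : ∀ x, 0 < g x)
    (hi : IntegrableOn g (Ici δ)) : ∫ s in δ..x, g s < ∫ s in Ici δ, g s := by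
  rw [integral_Ici_eq_integral_Ioi]
  have hi' : IntegrableOn g (Ioi δ) := hi.mono_set Ioi_subset_Ici_self
  have h2 : ∫ s in δ..(x+1), g s ≤ ∫ s in Ioi δ, g s := by
    rw [intervalIntegral.integral_of_le (by linarith)]
    exact setIntegral_mono_set hi' (Filter.Eventually.of_forall fun s => (hp s).le)
      (Ioc_subset_Ioi_self.eventuallyLE)
  have h3 : 0 < ∫ s in x..(x+1), g s :=
    intervalIntegral.intervalIntegral_pos_of_pos (hg.intervalIntegrable _ _) hp (by linarith)
  rw [← intervalIntegral.integral_add_adjacent_intervals (hg.intervalIntegrable δ x)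
    (hg.intervalIntegrable _ _)] at h2
  linarith

lemma cdelta_pos (δ : ℝ) : 0 < cdelta δ := by
  have := tail_pos (fun s : ℝ => Real.exp (-s^2/2)) δ δ le_rfl (by fun_prop)
    (fun x => Real.exp_pos _) gauss_int.integrableOn
  simpa [cdelta] using this

lemma Phid_deriv (δ r : ℝ) :
    HasStrictDerivAt (Phid δ) ((cdelta δ)⁻¹ * Real.exp (-r^2/2)) r := by
  have hc : Continuous (fun s : ℝ => Real.exp (-s^2/2)) := by fun_prop
  exact (hc.integral_hasStrictDerivAt δ r).const_mul _

lemma Phid_mono (δ : ℝ) : StrictMono (Phid δ) := by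
  apply strictMono_of_deriv_pos
  intro x
  rw [(Phid_deriv δ x).hasDerivAt.deriv]
  have := cdelta_pos δ
  positivity

lemma Phid_self (δ : ℝ) : Phid δ δ = 0 := by simp [Phid]

lemma Phid_surj (δ u : ℝ) (h0 : 0 ≤ u) (h1 : u < 1) : ∃ r, δ ≤ r ∧ Phid δ r = u := by
  have ht : Filter.Tendsto (Phid δ) Filter.atTop (nhds 1) := by
    have := (intervalIntegral_tendsto_integral_Ioi (μ := volume) δ
      (gauss_int.integrableOn) Filter.tendsto_id).const_mul (cdelta δ)⁻¹
    rw [← integral_Ici_eq_integral_Ioi, ← cdelta, inv_mul_cancel₀ (cdelta_pos δ).ne'] at this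
    exact this
  obtain ⟨b, hb, hbδ⟩ := ((ht.eventually (lt_mem_nhds h1)).and
    (Filter.eventually_ge_atTop δ)).exists
  have hcont : ContinuousOn (Phid δ) (Icc δ b) :=
    fun x _ => (Phid_deriv δ x).hasDerivAt.continuousAt.continuousWithinAt
  have := intermediate_value_Icc hbδ hcont (show u ∈ Icc _ _ from ⟨by rwa [Phid_self], hb.le⟩)
  obtain ⟨r, hr, h⟩ := this
  exact ⟨r, hr.1, h⟩

lemma PhidInv_Phid (δ r : ℝ) (hr : δ ≤ r) : PhidInv δ (Phid δ r) = r := by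
  have : {s : ℝ | δ ≤ s ∧ Phid δ r ≤ Phid δ s} = Ici r := by
    ext s
    simp only [mem_ofPred_eq, mem_Ici, (Phid_mono δ).le_iff_le]
    exact ⟨fun h => h.2, fun h => ⟨hr.trans h, h⟩⟩
  rw [PhidInv, this, csInf_Ici]

/-- global left inverse of `Phid`. -/
noncomputable def PhG (δ : ℝ) : ℝ → ℝ := Function.invFun (Phid δ)

lemma PhG_Phid (δ r : ℝ) : PhG δ (Phid δ r) = r :=
  Function.leftInverse_invFun (Phid_mono δ).injective r

lemma PhG_deriv (δ u : ℝ) (h0 : 0 ≤ u) (h1 : u < 1) :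
    HasDerivAt (PhG δ) (cdelta δ * Real.exp ((PhG δ u) ^ 2 / 2)) u := by
  obtain ⟨r, hr, rfl⟩ := Phid_surj δ u h0 h1
  have hc := cdelta_pos δ
  have := (Phid_deriv δ r).to_local_left_inverse (g := PhG δ) (by positivity)
    (Filter.Eventually.of_forall (PhG_Phid δ))
  refine HasDerivAt.congr_deriv this.hasDerivAt ?_
  rw [PhG_Phid, mul_inv, inv_inv, ← Real.exp_neg]
  congr 2; ring

lemma PhG_eq (δ u : ℝ) (h0 : 0 ≤ u) (h1 : u < 1) : PhidInv δ u = PhG δ u := by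
  obtain ⟨r, hr, rfl⟩ := Phid_surj δ u h0 h1
  rw [PhG_Phid, PhidInv_Phid δ r hr]

lemma aux_cont (δ b : ℝ) (hδb : δ ≤ b) (V f : ℝ → ℝ) (hV : Continuous V)
    (hV1 : ∫ x in Ici δ, Real.exp (V x) = 1) (hf : ContDiff ℝ 1 f) (hfb : f b = 0)
    (hF : ∫ x in δ..b, f x ^ 2 * Real.exp (V x) = 1) :
    ∫ x in δ..b, Real.exp (V x) * (f x ^ 2 * Real.log (f x ^ 2)) ≤
      2 * ∫ x in δ..b, Real.exp (V x) * (alpha1 δ V x * (deriv f x) ^ 2) := by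
  have hVi : IntegrableOn (fun x => Real.exp (V x)) (Ici δ) := by
    by_contra h
    rw [integral_undef h] at hV1; norm_num at hV1
  have hfc := hf.continuous
  have hφ0 : ∀ x, δ ≤ x → 0 ≤ phiV δ V x := fun x hx =>
    intervalIntegral.integral_nonneg hx fun _ _ => (Real.exp_pos _).le
  have hφ1 : ∀ x, δ ≤ x → phiV δ V x < 1 := fun x hx => by
    rw [← hV1]
    exact tail_pos (fun x => Real.exp (V x)) δ x hx (by fun_prop) (fun _ => Real.exp_pos _) hVi
  have hφd : ∀ x, HasDerivAt (phiV δ V) (Real.exp (V x)) x := fun x =>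
    ((by fun_prop : Continuous (fun x => Real.exp (V x))).integral_hasStrictDerivAt δ x).hasDerivAt
  have hpc : Continuous (fun x => f x ^ 2 * Real.exp (V x)) := by fun_prop
  apply le_of_forall_pos_le_add
  intro ε hε
  set F : ℝ → ℝ := fun x => Real.exp (-ε) * ∫ s in δ..x, f s ^ 2 * Real.exp (V s) with hFdef
  have hF0 : ∀ x ∈ Icc δ b, 0 ≤ F x := fun x hx =>
    mul_nonneg (Real.exp_pos _).le
      (intervalIntegral.integral_nonneg hx.1 fun _ _ => by positivity)
  have hF1 : ∀ x ∈ Icc δ b, F x < 1 := fun x hx => by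
    have h1 : ∫ s in δ..x, f s ^ 2 * Real.exp (V s) ≤ 1 := by
      rw [← hF, ← intervalIntegral.integral_add_adjacent_intervals (hpc.intervalIntegrable δ x)
        (hpc.intervalIntegrable x b)]
      have : 0 ≤ ∫ s in x..b, f s ^ 2 * Real.exp (V s) :=
        intervalIntegral.integral_nonneg hx.2 fun _ _ => by positivity
      linarith
    have h2 : Real.exp (-ε) < 1 := by rw [Real.exp_lt_one_iff]; linarith
    calc F x ≤ Real.exp (-ε) * 1 := mul_le_mul_of_nonneg_left h1 (Real.exp_pos _).le
      _ < 1 := by linarith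
  have hFd : ∀ x, HasDerivAt F (Real.exp (-ε) * (f x ^ 2 * Real.exp (V x))) x := fun x =>
    ((hpc.integral_hasStrictDerivAt δ x).hasDerivAt).const_mul _
  have := aux_core δ b (cdelta δ) ε hδb (cdelta_pos δ) V f (fun x => PhG δ (phiV δ V x))
    (fun x => PhG δ (F x)) hV hf hfb hF ?_ ?_ ?_
  · refine this.trans (le_of_eq ?_)
    congr 2
    apply intervalIntegral.integral_congr
    intro x hx
    rw [uIcc_of_le hδb] at hx
    simp only [alpha1]
    rw [PhG_eq δ (phiV δ V x) (hφ0 x hx.1) (hφ1 x hx.1)]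
  · intro x hx
    have := (PhG_deriv δ _ (hφ0 x hx.1) (hφ1 x hx.1)).comp x (hφd x)
    refine HasDerivAt.congr_deriv this ?_
    rw [Real.exp_add]; ring
  · intro x hx
    have := (PhG_deriv δ _ (hF0 x hx) (hF1 x hx)).comp x (hFd x)
    refine HasDerivAt.congr_deriv this ?_
    ring
  · simp [phiV, hFdef]

theorem stmt10 (δ : ℝ) (V : ℝ → ℝ) (hV : ContinuousOn V (Ici δ))
    (hV1 : ∫ x in Ici δ, Real.exp (V x) = 1)
    (μ : Measure ℝ)
    (hμ : μ = (volume.restrict (Ici δ)).withDensity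
      (fun x => ENNReal.ofReal (Real.exp (V x)))) :
    ∀ f : ℝ → ℝ, ContDiff ℝ 1 f → HasCompactSupport f → ∫ x, f x ^ 2 ∂μ = 1 →
      ∫ x, f x ^ 2 * Real.log (f x ^ 2) ∂μ ≤
        2 * ∫ x, alpha1 δ V x * (deriv f x) ^ 2 ∂μ := by
  intro f hf hfs hf1
  obtain ⟨R, hR⟩ := hfs.isBounded.subset_closedBall 0
  set b := max δ (R + 1) with hb
  have hδb : δ ≤ b := le_max_left _ _
  have hout : ∀ x, b ≤ x → x ∉ tsupport f := by
    intro x hx hxmem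
    have h1 := hR hxmem
    rw [mem_closedBall_zero_iff, Real.norm_eq_abs] at h1
    have h2 := le_abs_self x
    have h3 := le_max_right δ (R + 1)
    linarith
  have hf0 : ∀ x, b ≤ x → f x = 0 := fun x hx => image_eq_zero_of_notMem_tsupport (hout x hx)
  have hd0 : ∀ x, b ≤ x → deriv f x = 0 := fun x hx => by
    by_contra h
    exact hout x hx (support_deriv_subset h)
  set Vext : ℝ → ℝ := fun x => V (max x δ) with hVext
  have hVV : ∀ x, δ ≤ x → Vext x = V x := fun x hx => by simp [hVext, max_eq_left hx]
  have hVcont : Continuous Vext :=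
    hV.comp_continuous (by fun_prop) (fun x => le_max_right x δ)
  have hVone : ∫ x in Ici δ, Real.exp (Vext x) = 1 := by
    rw [← hV1]
    exact setIntegral_congr_fun measurableSet_Ici fun x hx => by simp only [hVV x hx]
  have hconv : ∀ g : ℝ → ℝ, (∀ x, b ≤ x → g x = 0) →
      ∫ x, g x ∂μ = ∫ x in δ..b, Real.exp (Vext x) * g x := by
    intro g hg
    have hm : AEMeasurable (fun x => ENNReal.ofReal (Real.exp (V x)))
        (volume.restrict (Ici δ)) := by
      have : AEMeasurable V (volume.restrict (Ici δ)) := hV.aemeasurable measurableSet_Ici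
      exact (Real.measurable_exp.comp_aemeasurable this).ennreal_ofReal
    rw [hμ, integral_withDensity_eq_integral_toReal_smul₀ hm
      (Filter.Eventually.of_forall fun x => ENNReal.ofReal_lt_top),
      intervalIntegral.integral_of_le hδb, integral_Ici_eq_integral_Ioi]
    rw [setIntegral_eq_of_subset_of_forall_sdiff_eq_zero measurableSet_Ioi
      (Ioc_subset_Ioi_self : Ioc δ b ⊆ Ioi δ)]
    · apply setIntegral_congr_fun measurableSet_Ioc
      intro x hx
      simp only [smul_eq_mul]
      rw [ENNReal.toReal_ofReal (Real.exp_pos _).le, hVV x hx.1.le]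
    · intro x hx
      have : b ≤ x := by
        by_contra h
        exact hx.2 ⟨hx.1, (not_le.mp h).le⟩
      simp [hg x this]
  have hα : ∀ x, δ ≤ x → alpha1 δ V x = alpha1 δ Vext x := by
    intro x hx
    have : phiV δ V x = phiV δ Vext x := by
      apply intervalIntegral.integral_congr
      intro y hy
      rw [uIcc_of_le hx] at hy
      simp only [hVV y hy.1]
    rw [alpha1, alpha1, this, hVV x hx]
  rw [hconv _ (fun x hx => by simp [hf0 x hx])] at hf1
  rw [hconv _ (fun x hx => by simp [hf0 x hx]), hconv _ (fun x hx => by simp [hd0 x hx])]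
  have := aux_cont δ b hδb Vext f hVcont hVone hf (hf0 b le_rfl) (by simpa [mul_comm] using hf1)
  convert this using 2
  apply intervalIntegral.integral_congr
  intro x hx
  rw [uIcc_of_le hδb] at hx
  simp only [hα x hx.1]
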